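/- Set L̂ = MD, P̂₁ = I and P̂_j = (I − J_j⁻¹)/(q − q⁻¹) for j ≥ 2. Then for every k ≥ 2 the universal quantum matrix Capelli identity holds in Mat_{N^{k}}(A): L̂_{⟨1⟩} (L̂_{⟨2⟩} − P̂₂) (L̂_{⟨3⟩} − P̂₃) ⋯ (L̂_{⟨k⟩} − P̂_k) = M_{⟨1→k⟩} · D_{⟨k→1⟩} · ∏_{s=1}^{k} J_s⁻¹. -/

import Mathlib

open scoped BigOperators

noncomputable section

/-- One-site embedding of an `N×N` matrix into `Mat_{N^k}` at 0-based position `i`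
(the paper's `X_{i+1}` in 1-based numbering).  Out of range we return the identity. -/
def matAt {α : Type*} [Semiring α] (N k : ℕ) (X : Matrix (Fin N) (Fin N) α) (i : ℕ) :
    Matrix (Fin k → Fin N) (Fin k → Fin N) α :=
  if h : i < k then
    Matrix.of fun a b =>
      if ∀ l : Fin k, (l : ℕ) ≠ i → a l = b l then X (a ⟨i, h⟩) (b ⟨i, h⟩) else 0
  else 1

/-- Two-site embedding of an operator on `V⊗V` into `Mat_{N^k}` at 0-based positions
`i, i+1` (the paper's `R_{i+1}` in 1-based numbering). -/
def opAt {α : Type*} [Semiring α] (N k : ℕ)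
    (R : Matrix (Fin N × Fin N) (Fin N × Fin N) α) (i : ℕ) :
    Matrix (Fin k → Fin N) (Fin k → Fin N) α :=
  if h : i + 1 < k then
    Matrix.of fun a b =>
      if ∀ l : Fin k, (l : ℕ) ≠ i → (l : ℕ) ≠ i + 1 → a l = b l then
        R (a ⟨i, by omega⟩, a ⟨i + 1, h⟩) (b ⟨i, by omega⟩, b ⟨i + 1, h⟩)
      else 0
  else 1

/-- A numeric (complex) matrix viewed inside `Mat(A)` via the unit of `A`. -/
def toA (A : Type*) [Semiring A] [Algebra ℂ A] {ι : Type*} (X : Matrix ι ι ℂ) :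
    Matrix ι ι A :=
  X.map (algebraMap ℂ A)

/-- The braid relation `R₁R₂R₁ = R₂R₁R₂` on `V^{⊗3}`. -/
def IsBraid (N : ℕ) (R : Matrix (Fin N × Fin N) (Fin N × Fin N) ℂ) : Prop :=
  opAt N 3 R 0 * opAt N 3 R 1 * opAt N 3 R 0 = opAt N 3 R 1 * opAt N 3 R 0 * opAt N 3 R 1

/-- The Hecke condition `(q·I − R)(q⁻¹·I + R) = 0`. -/
def IsHecke (N : ℕ) (q : ℂ) (R : Matrix (Fin N × Fin N) (Fin N × Fin N) ℂ) : Prop :=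
  (q • (1 : Matrix (Fin N × Fin N) (Fin N × Fin N) ℂ) - R) * (q⁻¹ • 1 + R) = 0

/-- `q` is generic: `q ∉ {0, 1, −1}` and `qⁿ ≠ 1` for all positive integers `n`. -/
def GenericQ (q : ℂ) : Prop :=
  q ≠ 0 ∧ q ≠ 1 ∧ q ≠ -1 ∧ ∀ n : ℕ, 0 < n → q ^ n ≠ 1

/-- The reflection-equation type relation `R X₁ R X₁ = X₁ R X₁ R` in `Mat_{N²}`. -/
def RErel {α : Type*} [Semiring α] (N : ℕ)
    (R : Matrix (Fin N × Fin N) (Fin N × Fin N) α) (X : Matrix (Fin N) (Fin N) α) : Prop :=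
  opAt N 2 R 0 * matAt N 2 X 0 * opAt N 2 R 0 * matAt N 2 X 0 =
    matAt N 2 X 0 * opAt N 2 R 0 * matAt N 2 X 0 * opAt N 2 R 0

/-- The quantum-double permutation relation `D₁ R M₁ R = R M₁ R⁻¹ D₁ + R` in `Mat_{N²}(A)`. -/
def PermRel {A : Type*} [Ring A] [Algebra ℂ A] (N : ℕ)
    (R Rinv : Matrix (Fin N × Fin N) (Fin N × Fin N) ℂ)
    (M D : Matrix (Fin N) (Fin N) A) : Prop :=
  matAt N 2 D 0 * opAt N 2 (toA A R) 0 * matAt N 2 M 0 * opAt N 2 (toA A R) 0 =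
    opAt N 2 (toA A R) 0 * matAt N 2 M 0 * opAt N 2 (toA A Rinv) 0 * matAt N 2 D 0 +
      opAt N 2 (toA A R) 0

/-- The homogeneous permutation relation `D₁ R M₁ R = R M₁ R⁻¹ D₁` in `Mat_{N²}(A)`. -/
def PermRelHom {A : Type*} [Ring A] [Algebra ℂ A] (N : ℕ)
    (R Rinv : Matrix (Fin N × Fin N) (Fin N × Fin N) ℂ)
    (M D : Matrix (Fin N) (Fin N) A) : Prop :=
  matAt N 2 D 0 * opAt N 2 (toA A R) 0 * matAt N 2 M 0 * opAt N 2 (toA A R) 0 =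
    opAt N 2 (toA A R) 0 * matAt N 2 M 0 * opAt N 2 (toA A Rinv) 0 * matAt N 2 D 0

/-- Overline copies: `ovCopy … r = X_{⟨r+1⟩}`, i.e. `X_{⟨1⟩} = X⊗I⊗⋯⊗I` and
`X_{⟨r+1⟩} = R_r X_{⟨r⟩} R_r⁻¹`. -/
def ovCopy {α : Type*} [Semiring α] (N k : ℕ)
    (R Rinv : Matrix (Fin N × Fin N) (Fin N × Fin N) α)
    (X : Matrix (Fin N) (Fin N) α) : ℕ → Matrix (Fin k → Fin N) (Fin k → Fin N) α
  | 0 => matAt N k X 0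
  | r + 1 => opAt N k R r * ovCopy N k R Rinv X r * opAt N k Rinv r

/-- Underline copies: `unCopy … r = X_{[r+1]}`, i.e. `X_{[1]} = X⊗I⊗⋯⊗I` and
`X_{[r+1]} = R_r⁻¹ X_{[r]} R_r`. -/
def unCopy {α : Type*} [Semiring α] (N k : ℕ)
    (R Rinv : Matrix (Fin N × Fin N) (Fin N × Fin N) α)
    (X : Matrix (Fin N) (Fin N) α) : ℕ → Matrix (Fin k → Fin N) (Fin k → Fin N) α
  | 0 => matAt N k X 0
  | r + 1 => opAt N k Rinv r * unCopy N k R Rinv X r * opAt N k R r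

/-- `X_{⟨1→n⟩} = X_{⟨1⟩}X_{⟨2⟩}⋯X_{⟨n⟩}`. -/
def ovProd {α : Type*} [Semiring α] (N k : ℕ)
    (R Rinv : Matrix (Fin N × Fin N) (Fin N × Fin N) α)
    (X : Matrix (Fin N) (Fin N) α) (n : ℕ) : Matrix (Fin k → Fin N) (Fin k → Fin N) α :=
  ((List.range n).map (ovCopy N k R Rinv X)).prod

/-- `X_{⟨n→1⟩} = X_{⟨n⟩}X_{⟨n−1⟩}⋯X_{⟨1⟩}`. -/
def ovProdRev {α : Type*} [Semiring α] (N k : ℕ)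
    (R Rinv : Matrix (Fin N × Fin N) (Fin N × Fin N) α)
    (X : Matrix (Fin N) (Fin N) α) (n : ℕ) : Matrix (Fin k → Fin N) (Fin k → Fin N) α :=
  ((List.range n).reverse.map (ovCopy N k R Rinv X)).prod

/-- Shifted Jucys–Murphy matrices: `JMup … R n s = J_{s+1}^{↑n}`, i.e. `J₁^{↑n} = I` and
`J_{s+1}^{↑n} = R_{n+s} J_s^{↑n} R_{n+s}` (paper's 1-based `R_{n+s}` is `opAt … (n+s-1)`).
Applying it to `R⁻¹` produces `(J_{s+1}^{↑n})⁻¹`. -/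
def JMup {α : Type*} [Semiring α] (N k : ℕ)
    (R : Matrix (Fin N × Fin N) (Fin N × Fin N) α) (n : ℕ) :
    ℕ → Matrix (Fin k → Fin N) (Fin k → Fin N) α
  | 0 => 1
  | s + 1 => opAt N k R (n + s) * JMup N k R n s * opAt N k R (n + s)

/-- The quantum trace `Tr_{R(1…n)}(X) = Tr(C₁C₂⋯C_n X)`. -/
def qTr {α : Type*} [Semiring α] (N n : ℕ) (C : Matrix (Fin N) (Fin N) α)
    (X : Matrix (Fin n → Fin N) (Fin n → Fin N) α) : α :=
  Matrix.trace (((List.range n).map (matAt N n C)).prod * X)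

/-- The matrix `C`, `C_i^j = Σ_k Ψ_{ik}^{jk}`. -/
def traceMat (N : ℕ) (Ψ : Matrix (Fin N × Fin N) (Fin N × Fin N) ℂ) :
    Matrix (Fin N) (Fin N) ℂ :=
  Matrix.of fun i j => ∑ k, Ψ (i, k) (j, k)

/-- Skew-invertibility of `R`: `Tr₂(R₁₂Ψ₂₃) = Tr₂(Ψ₁₂R₂₃) = P₁₃`, written componentwise. -/
def SkewInv (N : ℕ) (R Ψ : Matrix (Fin N × Fin N) (Fin N × Fin N) ℂ) : Prop :=
  (∀ i k l n : Fin N, ∑ j, ∑ b, R (i, j) (l, b) * Ψ (b, k) (j, n) =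
      if i = n ∧ k = l then 1 else 0) ∧
  (∀ i k l n : Fin N, ∑ j, ∑ b, Ψ (i, j) (l, b) * R (b, k) (j, n) =
      if i = n ∧ k = l then 1 else 0)

/-- The generators `R₁, …, R_{n−1}` (1-based) of the Hecke-algebra image inside
`End(V^{⊗k})`, as a subset of `Mat_{N^k}`. -/
def genSet {α : Type*} [Semiring α] (N k n : ℕ)
    (R : Matrix (Fin N × Fin N) (Fin N × Fin N) α) :
    Set (Matrix (Fin k → Fin N) (Fin k → Fin N) α) :=
  {X | ∃ i : ℕ, i + 1 < n ∧ X = opAt N k R i}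

/-- The left ideal of `A` generated by the entries of `D`. -/
def entryIdeal (A : Type*) [Ring A] {N : ℕ} (D : Matrix (Fin N) (Fin N) A) :
    Submodule A A :=
  Submodule.span A {x : A | ∃ i j : Fin N, x = D i j}

/-- The normally ordered monomial `:L̂_{⟨1→k⟩}: = M_{⟨1→k⟩} D_{⟨k→1⟩} ∏_{s=1}^{k} J_s⁻¹`. -/
def normOrd {α : Type*} [Semiring α] (N k : ℕ)
    (R Rinv : Matrix (Fin N × Fin N) (Fin N × Fin N) α)
    (M D : Matrix (Fin N) (Fin N) α) (n : ℕ) :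
    Matrix (Fin k → Fin N) (Fin k → Fin N) α :=
  ovProd N k R Rinv M n * ovProdRev N k R Rinv D n *
    ((List.range n).map (fun s => JMup N k Rinv 0 s)).prod

section HeckeTower

variable {B : Type*} [Ring B]

/-- The iterated conjugates `x, r₀ x r₀⁻¹, r₁ r₀ x r₀⁻¹ r₁⁻¹, …` -/
def conjCopy (r : ℕ → Bˣ) (x : B) : ℕ → B
  | 0 => x
  | n + 1 => r n * conjCopy r x n * ↑(r n)⁻¹

/-- The inverse Jucys–Murphy elements of a sequence of units. -/
def invJM (r : ℕ → Bˣ) : ℕ → B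
  | 0 => 1
  | n + 1 => ↑(r n)⁻¹ * invJM r n * ↑(r n)⁻¹

/-- The descending product `x (n-1) * ⋯ * x 0`. -/
def descProd (x : ℕ → B) (n : ℕ) : B := ((List.range n).reverse.map x).prod

lemma descProd_succ (x : ℕ → B) (n : ℕ) : descProd x (n + 1) = x n * descProd x n := by
  simp [descProd, List.range_succ]

variable {r : ℕ → Bˣ} {x m d : B}

lemma conjCopy_mul (n : ℕ) :
    conjCopy r (m * d) n = conjCopy r m n * conjCopy r d n := by
  induction n with
  | zero => rfl
  | succ n ih => simp [conjCopy, ih, mul_assoc]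

lemma commute_conjCopy_of_lt (hfar : ∀ i j, i + 2 ≤ j → Commute (r i : B) (r j))
    (hx : ∀ i, 1 ≤ i → Commute (r i : B) x) {n i : ℕ} (h : n < i) :
    Commute (r i : B) (conjCopy r x n) := by
  induction n with
  | zero => exact hx i h
  | succ n ih =>
    have h1 : Commute (r i : B) (r n) := (hfar n i h).symm
    exact (h1.mul_right (ih (by omega))).mul_right h1.units_inv_right

lemma commute_invJM_of_lt (hfar : ∀ i j, i + 2 ≤ j → Commute (r i : B) (r j))
    {n i : ℕ} (h : n < i) : Commute (r i : B) (invJM r n) := by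
  induction n with
  | zero => exact Commute.one_right _
  | succ n ih =>
    have h1 : Commute (r i : B) (r n) := (hfar n i h).symm
    exact (h1.units_inv_right.mul_right (ih (by omega))).mul_right h1.units_inv_right

variable {k : ℕ}

lemma commute_conjCopy_of_succ_lt (hfar : ∀ i j, i + 2 ≤ j → Commute (r i : B) (r j))
    (hbraid : ∀ i, i + 2 < k → r i * r (i + 1) * r i = r (i + 1) * r i * r (i + 1))
    (hx : ∀ i, 1 ≤ i → Commute (r i : B) x) {n i : ℕ} (hn : n < k) (h : i + 1 < n) :
    Commute (r i : B) (conjCopy r x n) := by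
  induction n with
  | zero => omega
  | succ n ih =>
    rcases Nat.lt_or_ge (i + 1) n with h' | h'
    · have h1 : Commute (r i : B) (r n) := hfar i n h'
      exact (h1.mul_right (ih (by omega) h')).mul_right h1.units_inv_right
    · obtain rfl : n = i + 1 := by omega
      have hb := hbraid i (by omega)
      have hc := commute_conjCopy_of_lt hfar hx (Nat.lt_succ_self i)
      have h1 : (r i : B) * (r (i + 1) * r i : Bˣ) = (r (i + 1) * r i : Bˣ) * r (i + 1) := by
        exact_mod_cast (mul_assoc (r i) _ _).symm.trans hb
      have h2 : conjCopy r x (i + 1 + 1) =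
          (r (i + 1) * r i : Bˣ) * conjCopy r x i * ↑(r (i + 1) * r i)⁻¹ := by
        simp [conjCopy, mul_assoc]
      have h3 : (r (i + 1) : B) * ↑(r (i + 1) * r i)⁻¹ = ↑(r (i + 1) * r i)⁻¹ * (r i : B) := by
        rw [Units.eq_inv_mul_iff_mul_eq, ← mul_assoc, ← h1, Units.mul_inv_cancel_right]
      rw [h2, Commute, SemiconjBy, ← mul_assoc, ← mul_assoc, h1, mul_assoc _ (r (i + 1) : B),
        hc.eq, ← mul_assoc, mul_assoc _ (r (i + 1) : B), h3, ← mul_assoc]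

lemma commute_invJM_of_succ_lt (hfar : ∀ i j, i + 2 ≤ j → Commute (r i : B) (r j))
    (hbraid : ∀ i, i + 2 < k → r i * r (i + 1) * r i = r (i + 1) * r i * r (i + 1))
    {n i : ℕ} (hn : n < k) (h : i + 1 < n) :
    Commute (r i : B) (invJM r n) := by
  induction n with
  | zero => omega
  | succ n ih =>
    rcases Nat.lt_or_ge (i + 1) n with h' | h'
    · have h1 : Commute (r i : B) (r n) := hfar i n h'
      exact (h1.units_inv_right.mul_right (ih (by omega) h')).mul_right h1.units_inv_right
    · obtain rfl : n = i + 1 := by omega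
      have hb := hbraid i (by omega)
      have hc := commute_invJM_of_lt hfar (Nat.lt_succ_self i)
      have h2 : invJM r (i + 1 + 1) =
          ↑((r (i + 1))⁻¹ * (r i)⁻¹) * invJM r i * ↑((r i)⁻¹ * (r (i + 1))⁻¹) := by
        simp [invJM, mul_assoc]
      have h1 : (r i : B) * ↑((r (i + 1))⁻¹ * (r i)⁻¹) =
          ↑((r (i + 1))⁻¹ * (r i)⁻¹) * (r (i + 1) : B) := by
        rw [← Units.val_mul, ← Units.val_mul]
        congr 1
        rw [← mul_assoc, eq_comm, ← mul_inv_rev, inv_mul_eq_iff_eq_mul, ← mul_assoc, ← mul_assoc,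
          eq_mul_inv_iff_mul_eq, eq_mul_inv_iff_mul_eq, ← hb, mul_assoc]
      have h3 : (r (i + 1) : B) * ↑((r i)⁻¹ * (r (i + 1))⁻¹) =
          ↑((r i)⁻¹ * (r (i + 1))⁻¹) * (r i : B) := by
        rw [← Units.val_mul, ← Units.val_mul]
        congr 1
        rw [← mul_assoc, eq_comm, ← mul_inv_rev, inv_mul_eq_iff_eq_mul, ← mul_assoc, ← mul_assoc,
          eq_mul_inv_iff_mul_eq, eq_mul_inv_iff_mul_eq, mul_assoc, ← hb, mul_assoc]
      rw [h2, Commute, SemiconjBy, ← mul_assoc, ← mul_assoc, h1, mul_assoc _ (r (i + 1) : B),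
        hc.eq, ← mul_assoc, mul_assoc _ (r (i + 1) : B), h3, ← mul_assoc]

lemma Commute.invJM_left {y : B} {n : ℕ} (h : ∀ i, i < n → Commute (r i : B) y) :
    Commute (invJM r n) y := by
  induction n with
  | zero => exact Commute.one_left _
  | succ n ih =>
    have h1 := (h n (Nat.lt_succ_self n)).units_inv_left
    exact (h1.mul_left (ih fun i hi => h i (by omega))).mul_left h1

/-- Conjugation by `r n * r (n + 1)` shifts the copies by one. -/
lemma conjCopy_succ_eq (hfar : ∀ i j, i + 2 ≤ j → Commute (r i : B) (r j))
    (hx : ∀ i, 1 ≤ i → Commute (r i : B) x) (n : ℕ) :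
    conjCopy r x (n + 1) =
      (r n * r (n + 1) : Bˣ) * conjCopy r x n * ↑(r n * r (n + 1))⁻¹ := by
  have hc := commute_conjCopy_of_lt hfar hx (Nat.lt_succ_self n)
  rw [Units.val_mul, mul_assoc (r n : B), hc.eq]
  simp [conjCopy, mul_assoc]

lemma generator_succ_eq {n : ℕ}
    (hb : r n * r (n + 1) * r n = r (n + 1) * r n * r (n + 1)) :
    r (n + 1) = (r n * r (n + 1)) * r n * (r n * r (n + 1))⁻¹ := by
  rw [hb, eq_mul_inv_iff_mul_eq, mul_assoc]

lemma permRel_conjCopy (hfar : ∀ i j, i + 2 ≤ j → Commute (r i : B) (r j))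
    (hbraid : ∀ i, i + 2 < k → r i * r (i + 1) * r i = r (i + 1) * r i * r (i + 1))
    (hm : ∀ i, 1 ≤ i → Commute (r i : B) m) (hd : ∀ i, 1 ≤ i → Commute (r i : B) d)
    (hdm : d * r 0 * m * r 0 = r 0 * m * ↑(r 0)⁻¹ * d + r 0) {n : ℕ} (hn : n + 1 < k) :
    conjCopy r d n * r n * conjCopy r m n * r n =
      r n * conjCopy r m n * ↑(r n)⁻¹ * conjCopy r d n + r n := by
  induction n with
  | zero => exact hdm
  | succ n ih =>
    have ih := ih (by omega)
    have hr := generator_succ_eq (hbraid n (by omega))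
    rw [conjCopy_succ_eq hfar hm, conjCopy_succ_eq hfar hd]
    generalize r n * r (n + 1) = u at *
    rw [hr]
    have := congrArg (fun y : B => u * y * ↑u⁻¹) ih
    simpa [mul_assoc, mul_add, add_mul] using this

lemma reflection_conjCopy (hfar : ∀ i j, i + 2 ≤ j → Commute (r i : B) (r j))
    (hbraid : ∀ i, i + 2 < k → r i * r (i + 1) * r i = r (i + 1) * r i * r (i + 1))
    (hd : ∀ i, 1 ≤ i → Commute (r i : B) d)
    (hdd : ↑(r 0)⁻¹ * d * ↑(r 0)⁻¹ * d = d * ↑(r 0)⁻¹ * d * ↑(r 0)⁻¹)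
    {n : ℕ} (hn : n + 1 < k) :
    ↑(r n)⁻¹ * conjCopy r d n * ↑(r n)⁻¹ * conjCopy r d n =
      conjCopy r d n * ↑(r n)⁻¹ * conjCopy r d n * ↑(r n)⁻¹ := by
  induction n with
  | zero => exact hdd
  | succ n ih =>
    have ih := ih (by omega)
    have hr := generator_succ_eq (hbraid n (by omega))
    rw [conjCopy_succ_eq hfar hd]
    generalize r n * r (n + 1) = u at *
    rw [hr]
    have := congrArg (fun y : B => u * y * ↑u⁻¹) ih
    simpa [mul_assoc] using this

lemma commute_descProd_conjCopy (hfar : ∀ i j, i + 2 ≤ j → Commute (r i : B) (r j))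
    (hd : ∀ i, 1 ≤ i → Commute (r i : B) d) (n : ℕ) :
    Commute (r n : B) (descProd (conjCopy r d) n) := by
  refine Commute.list_prod_right _ _ fun y hy => ?_
  obtain ⟨i, hi, rfl⟩ := List.mem_map.1 hy
  exact commute_conjCopy_of_lt hfar hd (by simpa using hi)

variable [Algebra ℂ B] {c : ℂ}

/-- Moving the descending product of the `d`-copies to the right of the next copy of `m * d`. -/
lemma descProd_mul_conjCopy (hc : c ≠ 0) (hfar : ∀ i j, i + 2 ≤ j → Commute (r i : B) (r j))
    (hbraid : ∀ i, i + 2 < k → r i * r (i + 1) * r i = r (i + 1) * r i * r (i + 1))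
    (hhecke : ∀ i, i + 1 < k → (r i : B) - ↑(r i)⁻¹ = c • 1)
    (hm : ∀ i, 1 ≤ i → Commute (r i : B) m) (hd : ∀ i, 1 ≤ i → Commute (r i : B) d)
    (hdd : ↑(r 0)⁻¹ * d * ↑(r 0)⁻¹ * d = d * ↑(r 0)⁻¹ * d * ↑(r 0)⁻¹)
    (hdm : d * r 0 * m * r 0 = r 0 * m * ↑(r 0)⁻¹ * d + r 0) {n : ℕ} (hn : n < k) :
    descProd (conjCopy r d) n * (conjCopy r m n * conjCopy r d n) =
      conjCopy r m n * conjCopy r d n * descProd (conjCopy r d) n * invJM r n +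
        descProd (conjCopy r d) n * (c⁻¹ • (1 - invJM r n)) := by
  induction n with
  | zero => simp [descProd, invJM]
  | succ n ih =>
    have ih := ih (by omega)
    have h1 := permRel_conjCopy hfar hbraid hm hd hdm hn
    have h2 := reflection_conjCopy hfar hbraid hd hdd hn
    have h3 := commute_descProd_conjCopy hfar hd n
    have h3' : Commute (↑(r n)⁻¹ : B) (descProd (conjCopy r d) n) := h3.units_inv_left
    have h4 := hhecke n hn
    rw [descProd_succ]
    simp only [conjCopy, invJM]
    set X := descProd (conjCopy r d) n
    set E := conjCopy r d n
    set F := conjCopy r m n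
    set J := invJM r n
    set u := r n
    set P := c⁻¹ • (1 - J) with hP
    have hJ : J = 1 - c • P := by rw [hP, smul_inv_smul₀ hc]; abel
    have h5 : E * u * F = u * F * ↑u⁻¹ * E * ↑u⁻¹ + 1 := by
      have := congrArg (· * (↑u⁻¹ : B)) h1
      simpa [add_mul] using this
    have h6 : E * ↑u⁻¹ * E = u * E * ↑u⁻¹ * E * ↑u⁻¹ := by
      have := congrArg ((u : B) * ·) h2
      simpa [mul_assoc] using this
    have h7 : J + u * P = 1 + ↑u⁻¹ * P := by
      have : (u : B) * P = ↑u⁻¹ * P + c • P := by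
        rw [← sub_eq_iff_eq_add', ← sub_mul, h4, smul_mul_assoc, one_mul]
      rw [this, hJ]; abel
    have h8 : c⁻¹ • (1 - ↑u⁻¹ * J * ↑u⁻¹ : B) = (1 + ↑u⁻¹ * P) * ↑u⁻¹ := by
      have h9 : (1 : B) - ↑u⁻¹ * ↑u⁻¹ = c • ↑u⁻¹ := by
        have := congrArg (· * (↑u⁻¹ : B)) h4
        simpa [sub_mul] using this
      rw [inv_smul_eq_iff₀ hc, hJ]
      have h10 : (1 : B) - ↑u⁻¹ * (1 - c • P) * ↑u⁻¹ =
          (1 - ↑u⁻¹ * ↑u⁻¹) + c • (↑u⁻¹ * P * ↑u⁻¹) := by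
        simp only [mul_sub, sub_mul, mul_smul_comm, smul_mul_assoc, mul_one]
        abel
      rw [h10, h9, add_mul, one_mul, smul_add]
    rw [h8, ← h7]
    calc E * X * (u * F * ↑u⁻¹ * (u * E * ↑u⁻¹))
        = E * (X * u) * (F * E) * ↑u⁻¹ := by simp [mul_assoc]
      _ = E * u * (X * (F * E)) * ↑u⁻¹ := by rw [← h3.eq]; simp only [mul_assoc]
      _ = (E * u * F) * (E * X * J * ↑u⁻¹) + E * (u * X) * P * ↑u⁻¹ := by
          rw [ih]; simp only [mul_add, add_mul, mul_assoc]
      _ = u * F * ↑u⁻¹ * E * ↑u⁻¹ * E * X * J * ↑u⁻¹ + E * X * (J + u * P) * ↑u⁻¹ := by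
          rw [h5, h3.eq]; simp only [mul_add, add_mul, mul_assoc, one_mul]; abel
      _ = u * F * ↑u⁻¹ * (E * ↑u⁻¹ * E) * X * J * ↑u⁻¹ + E * X * (J + u * P) * ↑u⁻¹ := by
          simp only [mul_assoc]
      _ = u * F * ↑u⁻¹ * u * E * ↑u⁻¹ * E * (↑u⁻¹ * X) * J * ↑u⁻¹
            + E * X * (J + u * P) * ↑u⁻¹ := by
          rw [h6]; simp only [mul_assoc]
      _ = _ := by rw [h3'.eq]; simp only [mul_assoc]

/-- The Capelli identity for an abstract tower of Hecke generators acting on a quantum double. -/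
theorem capelli_conjCopy (hc : c ≠ 0) (hfar : ∀ i j, i + 2 ≤ j → Commute (r i : B) (r j))
    (hbraid : ∀ i, i + 2 < k → r i * r (i + 1) * r i = r (i + 1) * r i * r (i + 1))
    (hhecke : ∀ i, i + 1 < k → (r i : B) - ↑(r i)⁻¹ = c • 1)
    (hm : ∀ i, 1 ≤ i → Commute (r i : B) m) (hd : ∀ i, 1 ≤ i → Commute (r i : B) d)
    (hdd : ↑(r 0)⁻¹ * d * ↑(r 0)⁻¹ * d = d * ↑(r 0)⁻¹ * d * ↑(r 0)⁻¹)
    (hdm : d * r 0 * m * r 0 = r 0 * m * ↑(r 0)⁻¹ * d + r 0) {n : ℕ} (hn : n ≤ k) :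
    ((List.range n).map fun i => conjCopy r (m * d) i - c⁻¹ • (1 - invJM r i)).prod =
      ((List.range n).map (conjCopy r m)).prod * descProd (conjCopy r d) n *
        ((List.range n).map (invJM r)).prod := by
  induction n with
  | zero => simp [descProd]
  | succ n ih =>
    have h := descProd_mul_conjCopy hc hfar hbraid hhecke hm hd hdd hdm hn
    have hJ : Commute ((List.range n).map (invJM r)).prod (invJM r n) := by
      refine Commute.list_prod_left _ _ fun y hy => ?_
      obtain ⟨j, hj, rfl⟩ := List.mem_map.1 hy
      rw [List.mem_range] at hj
      exact Commute.invJM_left fun i hi =>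
        commute_invJM_of_succ_lt hfar hbraid hn (by omega)
    have hL : Commute ((List.range n).map (invJM r)).prod
        (conjCopy r m n * conjCopy r d n) := by
      refine Commute.list_prod_left _ _ fun y hy => ?_
      obtain ⟨j, hj, rfl⟩ := List.mem_map.1 hy
      rw [List.mem_range] at hj
      exact Commute.invJM_left fun i hi =>
        (commute_conjCopy_of_succ_lt hfar hbraid hm hn (by omega)).mul_right
          (commute_conjCopy_of_succ_lt hfar hbraid hd hn (by omega))
    have hLP := hL.sub_right (((Commute.one_right _).sub_right hJ).smul_right c⁻¹)
    simp only [List.range_succ, List.map_append, List.map_cons, List.map_nil, List.prod_append,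
      List.prod_singleton]
    rw [ih (by omega), conjCopy_mul, descProd_succ, mul_assoc _ _ (_ - _), hLP.eq, hJ.eq]
    have h' : descProd (conjCopy r d) n *
        (conjCopy r m n * conjCopy r d n - c⁻¹ • (1 - invJM r n)) =
        conjCopy r m n * conjCopy r d n * descProd (conjCopy r d) n * invJM r n := by
      rw [mul_sub, h]; abel
    rw [← mul_assoc, mul_assoc _ (descProd _ _) (_ - _), h']
    simp only [mul_assoc]

end HeckeTower

section LocalOperators

variable {α : Type*} {N k m : ℕ} {i : ℕ}

/-- Split a multi-index into its `m` entries at positions `i, …, i + m - 1` and the others. -/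
def splitIndex (N : ℕ) (h : i + m ≤ k) :
    (Fin k → Fin N) ≃ (Fin m → Fin N) × ({l : Fin k // ¬ (i ≤ l ∧ (l : ℕ) < i + m)} → Fin N) where
  toFun a := (fun j => a ⟨i + j, by omega⟩, fun l => a l)
  invFun p l := if hl : i ≤ l ∧ (l : ℕ) < i + m then p.1 ⟨l - i, by omega⟩ else p.2 ⟨l, hl⟩
  left_inv a := by
    funext l
    by_cases hl : i ≤ l ∧ (l : ℕ) < i + m
    · simp [hl]
    · simp [hl]
  right_inv p := by
    refine Prod.ext (funext fun j => ?_) (funext fun l => ?_)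
    · simp
    · simp [l.2]

/-- The operator `I ⊗ X ⊗ I` with `X` acting in the tensor factors `i, …, i + m - 1`. -/
def localAt [Semiring α] (h : i + m ≤ k) (X : Matrix (Fin m → Fin N) (Fin m → Fin N) α) :
    Matrix (Fin k → Fin N) (Fin k → Fin N) α :=
  (Matrix.blockDiagonal fun _ => X).submatrix (splitIndex N h) (splitIndex N h)

lemma localAt_apply [Semiring α] (h : i + m ≤ k) (X : Matrix (Fin m → Fin N) (Fin m → Fin N) α)
    (a b : Fin k → Fin N) :
    localAt h X a b =
      if ∀ l : Fin k, ¬ (i ≤ l ∧ (l : ℕ) < i + m) → a l = b l then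
        X (fun j => a ⟨i + j, by omega⟩) (fun j => b ⟨i + j, by omega⟩) else 0 := by
  simp only [localAt, Matrix.submatrix_apply, splitIndex, Equiv.coe_fn_mk,
    Matrix.blockDiagonal_apply, funext_iff, Subtype.forall]

lemma localAt_mul [Semiring α] (h : i + m ≤ k)
    (X Y : Matrix (Fin m → Fin N) (Fin m → Fin N) α) :
    localAt h (X * Y) = localAt h X * localAt h Y := by
  rw [localAt, localAt, localAt, Matrix.submatrix_mul_equiv, ← Matrix.blockDiagonal_mul]

lemma localAt_one [Semiring α] (h : i + m ≤ k) :
    localAt h (1 : Matrix (Fin m → Fin N) (Fin m → Fin N) α) = 1 := by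
  have := Matrix.blockDiagonal_one (m := Fin m → Fin N) (α := α)
    (o := {l : Fin k // ¬ (i ≤ l ∧ (l : ℕ) < i + m)} → Fin N)
  rw [localAt, ← Matrix.submatrix_one_equiv (splitIndex N h), ← this]
  rfl

lemma localAt_add [Semiring α] (h : i + m ≤ k)
    (X Y : Matrix (Fin m → Fin N) (Fin m → Fin N) α) :
    localAt h (X + Y) = localAt h X + localAt h Y := by
  ext a b
  simp only [localAt_apply, Matrix.add_apply]
  split_ifs <;> simp

lemma opAt_add_eq_localAt [Semiring α] (h : i + m ≤ k)
    (R : Matrix (Fin N × Fin N) (Fin N × Fin N) α) {j : ℕ} (hj : j + 1 < m) :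
    opAt N k R (i + j) = localAt h (opAt N m R j) := by
  ext a b
  rw [localAt_apply, opAt, opAt, dif_pos (by omega), dif_pos hj]
  simp only [Matrix.of_apply]
  rw [← ite_and]
  refine if_congr ?_ (by simp [add_assoc]) rfl
  constructor
  · intro H
    exact ⟨fun l hl => H l (by omega) (by omega),
      fun l h1 h2 => H ⟨i + l, by omega⟩ (by simpa using h1) (by simp; omega)⟩
  · rintro ⟨H1, H2⟩ l h1 h2
    by_cases hl : i ≤ l ∧ (l : ℕ) < i + m
    · have := H2 ⟨l - i, by omega⟩ (by simp; omega) (by simp; omega)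
      simpa [Nat.add_sub_cancel' hl.1] using this
    · exact H1 l hl

lemma matAt_add_eq_localAt [Semiring α] (h : i + m ≤ k) (X : Matrix (Fin N) (Fin N) α)
    {j : ℕ} (hj : j < m) :
    matAt N k X (i + j) = localAt h (matAt N m X j) := by
  ext a b
  rw [localAt_apply, matAt, matAt, dif_pos (by omega), dif_pos hj]
  simp only [Matrix.of_apply]
  rw [← ite_and]
  refine if_congr ?_ rfl rfl
  constructor
  · intro H
    exact ⟨fun l hl => H l (by omega),
      fun l h1 => H ⟨i + l, by omega⟩ (by simpa using h1)⟩
  · rintro ⟨H1, H2⟩ l h1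
    by_cases hl : i ≤ l ∧ (l : ℕ) < i + m
    · have := H2 ⟨l - i, by omega⟩ (by simp; omega)
      simpa [Nat.add_sub_cancel' hl.1] using this
    · exact H1 l hl

/-- On two factors, `opAt` only re-indexes its operator. -/
lemma opAt_two [Semiring α] (R : Matrix (Fin N × Fin N) (Fin N × Fin N) α) :
    opAt N 2 R 0 = R.submatrix (finTwoArrowEquiv (Fin N)) (finTwoArrowEquiv (Fin N)) := by
  ext a b
  simp [opAt, Fin.forall_fin_two, finTwoArrowEquiv]

lemma matAt_one [Semiring α] (X : Matrix (Fin N) (Fin N) α) :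
    matAt N 1 X 0 = X.submatrix (Equiv.funUnique (Fin 1) (Fin N))
      (Equiv.funUnique (Fin 1) (Fin N)) := by
  ext a b
  simp [matAt]

lemma matAt_eq_localAt [Semiring α] (h : i + 1 ≤ k) (X : Matrix (Fin N) (Fin N) α) :
    matAt N k X i = localAt h (matAt N 1 X 0) :=
  matAt_add_eq_localAt h X Nat.zero_lt_one

lemma opAt_eq_localAt [Semiring α] (h : i + 2 ≤ k)
    (R : Matrix (Fin N × Fin N) (Fin N × Fin N) α) :
    opAt N k R i = localAt h (opAt N 2 R 0) :=
  opAt_add_eq_localAt h R Nat.one_lt_two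

lemma matAt_mul [Semiring α] (h : i < k) (X Y : Matrix (Fin N) (Fin N) α) :
    matAt N k (X * Y) i = matAt N k X i * matAt N k Y i := by
  simp only [matAt_eq_localAt (Nat.succ_le_of_lt h), matAt_one]
  rw [← Matrix.submatrix_mul_equiv X Y _ (Equiv.funUnique (Fin 1) (Fin N)), localAt_mul]

lemma opAt_of_le [Semiring α] (h : k ≤ i + 1) (R : Matrix (Fin N × Fin N) (Fin N × Fin N) α) :
    opAt N k R i = 1 := by
  rw [opAt, dif_neg (by omega)]

lemma opAt_mul [Semiring α] (R S : Matrix (Fin N × Fin N) (Fin N × Fin N) α) (i : ℕ) :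
    opAt N k (R * S) i = opAt N k R i * opAt N k S i := by
  rcases Nat.lt_or_ge (i + 1) k with h | h
  · simp only [opAt_eq_localAt (show i + 2 ≤ k from h), opAt_two]
    rw [← Matrix.submatrix_mul_equiv R S _ (finTwoArrowEquiv (Fin N)), localAt_mul]
  · simp [opAt_of_le h]

lemma opAt_one [Semiring α] (i : ℕ) :
    opAt N k (1 : Matrix (Fin N × Fin N) (Fin N × Fin N) α) i = 1 := by
  rcases Nat.lt_or_ge (i + 1) k with h | h
  · rw [opAt_eq_localAt (show i + 2 ≤ k from h), opAt_two, Matrix.submatrix_one_equiv, localAt_one]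
  · exact opAt_of_le h _

/-- Entries of a product of two local operators with disjoint supports. -/
lemma localAt_mul_localAt_apply [Semiring α] {j n : ℕ} (h : i + m ≤ k) (h' : j + n ≤ k)
    (hij : i + m ≤ j ∨ j + n ≤ i)
    (X : Matrix (Fin m → Fin N) (Fin m → Fin N) α) (Y : Matrix (Fin n → Fin N) (Fin n → Fin N) α)
    (a b : Fin k → Fin N) :
    (localAt h X * localAt h' Y) a b =
      if ∀ l : Fin k, ¬ (i ≤ l ∧ (l : ℕ) < i + m) → ¬ (j ≤ l ∧ (l : ℕ) < j + n) → a l = b l then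
        X (fun s => a ⟨i + s, by omega⟩) (fun s => b ⟨i + s, by omega⟩) *
          Y (fun s => a ⟨j + s, by omega⟩) (fun s => b ⟨j + s, by omega⟩) else 0 := by
  simp only [Matrix.mul_apply, localAt_apply]
  rw [Finset.sum_eq_single fun l : Fin k => if i ≤ l ∧ (l : ℕ) < i + m then b l else a l]
  · have e1 : ∀ s : Fin m, i ≤ i + (s : ℕ) ∧ i + (s : ℕ) < i + m := by omega
    have e2 : ∀ s : Fin n, ¬ (i ≤ j + (s : ℕ) ∧ j + (s : ℕ) < i + m) := by omega
    simp only [e1, e2, and_self, if_true, if_false]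
    rw [if_pos fun l hl => by rw [if_neg hl], mul_ite, mul_zero]
    refine if_congr (forall_congr' fun l => ?_) rfl rfl
    by_cases hl : i ≤ l ∧ (l : ℕ) < i + m
    · simp [hl]
    · simp only [hl, if_false, not_false_eq_true, true_imp_iff]
  · intro x _ hx
    by_cases h1 : ∀ l : Fin k, ¬ (i ≤ l ∧ (l : ℕ) < i + m) → a l = x l
    · rw [if_neg (c := ∀ l : Fin k, ¬ (j ≤ l ∧ (l : ℕ) < j + n) → x l = b l), mul_zero]
      intro h2
      refine hx (funext fun l => ?_)
      split_ifs with hl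
      · exact h2 l (by omega)
      · exact (h1 l hl).symm
    · rw [if_neg h1, zero_mul]
  · simp

/-- Local operators with disjoint supports and mutually commuting entries commute. -/
lemma localAt_commute [Semiring α] {j n : ℕ} (h : i + m ≤ k) (h' : j + n ≤ k) (hij : i + m ≤ j)
    {X : Matrix (Fin m → Fin N) (Fin m → Fin N) α} {Y : Matrix (Fin n → Fin N) (Fin n → Fin N) α}
    (hXY : ∀ a b c d, Commute (X a b) (Y c d)) :
    Commute (localAt h X) (localAt h' Y) := by
  ext a b
  rw [localAt_mul_localAt_apply h h' (Or.inl hij), localAt_mul_localAt_apply h' h (Or.inr hij),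
    (hXY _ _ _ _).eq]
  exact if_congr (forall_congr' fun l => imp.swap) rfl rfl

lemma opAt_map {β : Type*} [Semiring α] [Semiring β] (f : α →+* β)
    (R : Matrix (Fin N × Fin N) (Fin N × Fin N) α) (i : ℕ) :
    opAt N k (R.map f) i = (opAt N k R i).map f := by
  rcases Nat.lt_or_ge (i + 1) k with h | h
  · ext a b
    simp only [opAt, dif_pos h, Matrix.of_apply, Matrix.map_apply]
    split_ifs <;> simp
  · simp [opAt_of_le h]

end LocalOperators

section Capelli

variable {A : Type*} [Ring A] [Algebra ℂ A] {N k : ℕ}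

/-- The action of an invertible numeric `R` at position `i`, as a unit of `Mat_{N^k}(A)`. -/
def opUnit (A : Type*) [Ring A] [Algebra ℂ A] (k : ℕ)
    {R Rinv : Matrix (Fin N × Fin N) (Fin N × Fin N) ℂ}
    (hRinv : R * Rinv = 1 ∧ Rinv * R = 1) (i : ℕ) :
    (Matrix (Fin k → Fin N) (Fin k → Fin N) A)ˣ where
  val := opAt N k (toA A R) i
  inv := opAt N k (toA A Rinv) i
  val_inv := by
    rw [← opAt_mul, toA, toA, ← Matrix.map_mul, hRinv.1, Matrix.map_one _ (map_zero _) (map_one _),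
      opAt_one]
  inv_val := by
    rw [← opAt_mul, toA, toA, ← Matrix.map_mul, hRinv.2, Matrix.map_one _ (map_zero _) (map_one _),
      opAt_one]

lemma opAt_toA_commute (R S : Matrix (Fin N × Fin N) (Fin N × Fin N) ℂ) {i j : ℕ}
    (hij : i + 2 ≤ j) : Commute (opAt N k (toA A R) i) (opAt N k (toA A S) j) := by
  rcases Nat.lt_or_ge (j + 1) k with h | h
  · rw [opAt_eq_localAt (show i + 2 ≤ k by omega), opAt_eq_localAt (show j + 2 ≤ k from h)]
    refine localAt_commute _ _ hij fun a b c d => ?_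
    rw [toA, opAt_map]
    exact Algebra.commutes _ _
  · rw [opAt_of_le h]
    exact Commute.one_right _

lemma opAt_toA_commute_matAt (R : Matrix (Fin N × Fin N) (Fin N × Fin N) ℂ)
    (X : Matrix (Fin N) (Fin N) A) {i j : ℕ} (hij : i + 1 ≤ j) :
    Commute (opAt N k (toA A R) j) (matAt N k X i) := by
  rcases Nat.lt_or_ge (j + 1) k with h | h
  · rw [opAt_eq_localAt (show j + 2 ≤ k from h), matAt_eq_localAt (show i + 1 ≤ k by omega)]
    refine (localAt_commute _ _ hij fun a b c d => ?_).symm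
    rw [toA, opAt_map]
    exact (Algebra.commutes _ _).symm
  · rw [opAt_of_le h]
    exact Commute.one_left _

lemma opAt_toA_braid {R : Matrix (Fin N × Fin N) (Fin N × Fin N) ℂ} (hR : IsBraid N R) {i : ℕ}
    (h : i + 2 < k) :
    opAt N k (toA A R) i * opAt N k (toA A R) (i + 1) * opAt N k (toA A R) i =
      opAt N k (toA A R) (i + 1) * opAt N k (toA A R) i * opAt N k (toA A R) (i + 1) := by
  have h0 := opAt_add_eq_localAt (show i + 3 ≤ k from h) (toA A R) (j := 0) (by omega)
  have h1 := opAt_add_eq_localAt (show i + 3 ≤ k from h) (toA A R) (j := 1) (by omega)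
  rw [add_zero] at h0
  rw [h0, h1]
  simp only [← localAt_mul, toA, opAt_map, ← Matrix.map_mul]
  rw [hR]

lemma IsHecke.sub_inv_eq {q : ℂ} (hq : q ≠ 0) {R Rinv : Matrix (Fin N × Fin N) (Fin N × Fin N) ℂ}
    (hRinv : R * Rinv = 1) (hR : IsHecke N q R) : R = Rinv + (q - q⁻¹) • 1 := by
  have h : (q • 1 - R) * (q⁻¹ • 1 + R) * Rinv = 0 := by rw [hR, zero_mul]
  rw [mul_assoc, add_mul, hRinv] at h
  have h' : Rinv + q • 1 - q⁻¹ • (1 : Matrix (Fin N × Fin N) (Fin N × Fin N) ℂ) - R = 0 := by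
    rw [← h]
    simp only [sub_mul, mul_add, smul_mul_assoc, mul_smul_comm, one_mul, mul_one, hRinv,
      smul_sub, smul_smul, inv_mul_cancel₀ hq, one_smul]
    abel
  rw [sub_smul, ← add_sub_assoc]
  exact (sub_eq_zero.1 h').symm

lemma opAt_toA_hecke {q : ℂ} (hq : q ≠ 0) {R Rinv : Matrix (Fin N × Fin N) (Fin N × Fin N) ℂ}
    (hRinv : R * Rinv = 1) (hR : IsHecke N q R) {i : ℕ} (h : i + 1 < k) :
    opAt N k (toA A R) i - opAt N k (toA A Rinv) i = (q - q⁻¹) • 1 := by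
  conv_lhs => rw [hR.sub_inv_eq hq hRinv]
  ext a b
  have h1 := congrFun₂ (opAt_one (α := ℂ) (N := N) (k := k) i) a b
  simp only [opAt, dif_pos h, toA, Matrix.sub_apply, Matrix.of_apply, Matrix.map_apply,
    Matrix.add_apply, Matrix.smul_apply, map_add, smul_eq_mul, map_mul] at h1 ⊢
  have h2 : (1 : Matrix (Fin k → Fin N) (Fin k → Fin N) A) a b =
      algebraMap ℂ A ((1 : Matrix (Fin k → Fin N) (Fin k → Fin N) ℂ) a b) := by
    simp [Matrix.one_apply, apply_ite (algebraMap ℂ A)]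
  rw [h2, ← h1, Algebra.smul_def]
  split_ifs <;> simp

lemma ovCopy_eq_conjCopy {R Rinv : Matrix (Fin N × Fin N) (Fin N × Fin N) ℂ}
    (hRinv : R * Rinv = 1 ∧ Rinv * R = 1) (X : Matrix (Fin N) (Fin N) A) (n : ℕ) :
    ovCopy N k (toA A R) (toA A Rinv) X n = conjCopy (opUnit A k hRinv) (matAt N k X 0) n := by
  induction n with
  | zero => rfl
  | succ n ih => rw [ovCopy, ih]; rfl

lemma JMup_eq_invJM {R Rinv : Matrix (Fin N × Fin N) (Fin N × Fin N) ℂ}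
    (hRinv : R * Rinv = 1 ∧ Rinv * R = 1) (n : ℕ) :
    JMup N k (toA A Rinv) 0 n = invJM (opUnit A k hRinv) n := by
  induction n with
  | zero => rfl
  | succ n ih => rw [JMup, ih, zero_add]; rfl

lemma GenericQ.sub_inv_ne_zero {q : ℂ} (hq : GenericQ q) : q - q⁻¹ ≠ 0 := by
  intro h
  refine hq.2.2.2 2 two_pos ?_
  have := congrArg (q * ·) (sub_eq_zero.1 h)
  simpa [mul_inv_cancel₀ hq.1, sq] using this

end Capelli

/-- **universal quantum matrix Capelli identity.** With `L̂ = MD`,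
`P̂_j = (I − J_j⁻¹)/(q − q⁻¹)`, for every `k ≥ 2` in `Mat_{N^k}(A)`:
`L̂_{⟨1⟩}(L̂_{⟨2⟩} − P̂₂)⋯(L̂_{⟨k⟩} − P̂_k) = M_{⟨1→k⟩} D_{⟨k→1⟩} ∏_{s=1}^{k} J_s⁻¹`. -/
theorem stmt17 {A : Type*} [Ring A] [Algebra ℂ A] (N : ℕ) (hN : 1 ≤ N) (q : ℂ)
    (hq : GenericQ q)
    (R Rinv : Matrix (Fin N × Fin N) (Fin N × Fin N) ℂ)
    (hRinv : R * Rinv = 1 ∧ Rinv * R = 1)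
    (hbraid : IsBraid N R) (hHecke : IsHecke N q R)
    (M D : Matrix (Fin N) (Fin N) A)
    (hM : RErel N (toA A R) M)
    (hD : RErel N (toA A Rinv) D)
    (hDM : PermRel N R Rinv M D)
    (k : ℕ) (hk : 2 ≤ k) :
    ovCopy N k (toA A R) (toA A Rinv) (M * D) 0 *
        ((List.range' 2 (k - 1)).map (fun j =>
          ovCopy N k (toA A R) (toA A Rinv) (M * D) (j - 1) -
            (q - q⁻¹)⁻¹ •
              ((1 : Matrix (Fin k → Fin N) (Fin k → Fin N) A) -
                JMup N k (toA A Rinv) 0 (j - 1)))).prod =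
      normOrd N k (toA A R) (toA A Rinv) M D k := by
  have h2k : 0 + 2 ≤ k := by omega
  have hr0 : ∀ S : Matrix (Fin N × Fin N) (Fin N × Fin N) A,
      opAt N k S 0 = localAt h2k (opAt N 2 S 0) := opAt_eq_localAt h2k
  have hx0 : ∀ X : Matrix (Fin N) (Fin N) A,
      matAt N k X 0 = localAt h2k (matAt N 2 X 0) :=
    fun X => matAt_add_eq_localAt h2k X two_pos
  have key := capelli_conjCopy (k := k) (r := opUnit A k hRinv) (m := matAt N k M 0)
    (d := matAt N k D 0) hq.sub_inv_ne_zero (fun i j hij => opAt_toA_commute R R hij)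
    (fun i hi => Units.ext (opAt_toA_braid hbraid hi))
    (fun i hi => opAt_toA_hecke hq.1 hRinv.1 hHecke hi)
    (fun i hi => opAt_toA_commute_matAt R M hi) (fun i hi => opAt_toA_commute_matAt R D hi)
    (by
      change opAt N k (toA A Rinv) 0 * _ * opAt N k (toA A Rinv) 0 * _ =
        _ * opAt N k (toA A Rinv) 0 * _ * opAt N k (toA A Rinv) 0
      rw [hr0, hx0]
      simp only [← localAt_mul]
      exact congrArg _ hD)
    (by
      change _ * opAt N k (toA A R) 0 * _ * opAt N k (toA A R) 0 =
        opAt N k (toA A R) 0 * _ * opAt N k (toA A Rinv) 0 * _ + opAt N k (toA A R) 0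
      rw [hr0, hr0, hx0, hx0]
      simp only [← localAt_mul, ← localAt_add]
      exact congrArg _ hDM)
    le_rfl
  rw [← matAt_mul (by omega)] at key
  have hov : ∀ X : Matrix (Fin N) (Fin N) A,
      conjCopy (opUnit A k hRinv) (matAt N k X 0) = ovCopy N k (toA A R) (toA A Rinv) X :=
    fun X => funext fun n => (ovCopy_eq_conjCopy hRinv X n).symm
  have hJM : invJM (opUnit A k hRinv) = JMup N k (toA A Rinv) 0 :=
    funext fun n => (JMup_eq_invJM hRinv n).symm
  simp only [descProd, hov, hJM] at key
  rw [normOrd, ovProd, ovProdRev]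
  convert key using 1
  obtain ⟨n, rfl⟩ : ∃ n, k = n + 1 := ⟨k - 1, by omega⟩
  rw [List.range_succ_eq_map, List.map_cons, List.prod_cons, List.map_map, List.range'_eq_map_range,
    List.map_map]
  congr 1
  · simp [JMup]
  · congr 1
    simp only [Nat.add_sub_cancel]
    refine List.map_congr_left fun j _ => ?_
    simp [Nat.add_comm 2 j]
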